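/- arXiv:1211.5642 — 3 statements merged into one kernel-verified Lean document; each statement's English description precedes it below -/
import Mathlib

section
/- Let A be a symmetric nonnegative tensor of order k and dimension n, and suppose λ is the greatest H-eigenvalue of A (λ is an H-eigenvalue and every H-eigenvalue μ of A satisfies μ ≤ λ). Then λ ≥ R̄(A), the average of the row sums of A, and λ ≥ d_max(A), the largest diagonal entry of A. -/
open Finset

/-- `A x^k = ∑_{i₁,…,i_k} a_{i₁…i_k} x_{i₁}⋯x_{i_k}`. -/
def tApply (k n : ℕ) (A : (Fin k → Fin n) → ℝ) (x : Fin n → ℝ) : ℝ :=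
  ∑ f : Fin k → Fin n, A f * ∏ j : Fin k, x (f j)

/-- The `i`-th component of `A x^{k-1}`:
`∑_{i₂,…,i_k} a_{i i₂…i_k} x_{i₂}⋯x_{i_k}`. -/
def tApplyVec (k n : ℕ) (hk : 2 ≤ k) (A : (Fin k → Fin n) → ℝ) (x : Fin n → ℝ)
    (i : Fin n) : ℝ :=
  ∑ f ∈ Finset.univ.filter (fun f : Fin k → Fin n => f ⟨0, by omega⟩ = i),
    A f * ∏ j ∈ Finset.univ.erase (⟨0, by omega⟩ : Fin k), x (f j)

/-- A tensor is symmetric if its entries are invariant under permutations of the indices. -/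
def IsSymmTensor (k n : ℕ) (A : (Fin k → Fin n) → ℝ) : Prop :=
  ∀ (σ : Equiv.Perm (Fin k)) (f : Fin k → Fin n), A (f ∘ σ) = A f

/-- `lam` is an H-eigenvalue of `A`: there is a real `x ≠ 0` with `A x^{k-1} = lam x^{[k-1]}`. -/
def IsHEigenvalue (k n : ℕ) (hk : 2 ≤ k) (A : (Fin k → Fin n) → ℝ) (lam : ℝ) : Prop :=
  ∃ x : Fin n → ℝ, x ≠ 0 ∧ ∀ i : Fin n, tApplyVec k n hk A x i = lam * x i ^ (k - 1)

/-- The `i`-th row sum `R_i(A) = ∑_{i₂,…,i_k} a_{i i₂…i_k}`. -/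
def rowSum (k n : ℕ) (hk : 2 ≤ k) (A : (Fin k → Fin n) → ℝ) (i : Fin n) : ℝ :=
  ∑ f ∈ Finset.univ.filter (fun f : Fin k → Fin n => f ⟨0, by omega⟩ = i), A f

lemma tApply_smul_aux (k n : ℕ) (A : (Fin k → Fin n) → ℝ) (x : Fin n → ℝ) (c : ℝ) :
    tApply k n A (fun i => c * x i) = c ^ k * tApply k n A x := by
  unfold tApply
  rw [Finset.mul_sum]
  refine Finset.sum_congr rfl fun f _ => ?_
  rw [Finset.prod_mul_distrib]
  simp
  ring

lemma slot_aux (k n : ℕ) (hk : 2 ≤ k) (A : (Fin k → Fin n) → ℝ) (hsym : IsSymmTensor k n A)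
    (x : Fin n → ℝ) (i : Fin n) (j : Fin k) :
    ∑ f : Fin k → Fin n, A f * ((∏ l ∈ Finset.univ.erase j, x (f l)) * (if f j = i then 1 else 0))
      = tApplyVec k n hk A x i := by
  unfold tApplyVec
  rw [Finset.sum_filter]
  set z : Fin k := ⟨0, by omega⟩ with hz
  refine Fintype.sum_equiv (Equiv.arrowCongr (Equiv.swap j z) (Equiv.refl _)) _ _ fun f => ?_
  have h1 : (Equiv.arrowCongr (Equiv.swap j z) (Equiv.refl (Fin n))) f = f ∘ (Equiv.swap j z) := by
    ext l; simp [Equiv.arrowCongr]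
  rw [h1, hsym]
  have h2 : (f ∘ (Equiv.swap j z)) z = f j := by simp
  rw [h2]
  have h3 : ∏ l ∈ Finset.univ.erase j, x (f l)
      = ∏ l ∈ Finset.univ.erase z, x ((f ∘ (Equiv.swap j z)) l) := by
    refine Finset.prod_bij' (fun l _ => Equiv.swap j z l) (fun l _ => Equiv.swap j z l) ?_ ?_ ?_ ?_ ?_
    · intro l hl
      simp only [Finset.mem_erase, Finset.mem_univ, and_true] at hl ⊢
      intro h
      exact hl (by simpa using congrArg (Equiv.swap j z) h)
    · intro l hl
      simp only [Finset.mem_erase, Finset.mem_univ, and_true] at hl ⊢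
      intro h
      exact hl (by simpa using congrArg (Equiv.swap j z) h)
    · intro l _; simp
    · intro l _; simp
    · intro l _; simp
  rw [h3]
  split_ifs <;> simp

lemma coord_deriv_aux (n : ℕ) (x : Fin n → ℝ) (i m : Fin n) :
    HasDerivAt (fun t : ℝ => x m + t * (if m = i then 1 else 0)) (if m = i then 1 else 0) 0 := by
  simpa using ((hasDerivAt_id (0:ℝ)).mul_const (if m = i then (1:ℝ) else 0)).const_add (x m)

lemma tApply_deriv_aux (k n : ℕ) (hk : 2 ≤ k) (A : (Fin k → Fin n) → ℝ)
    (hsym : IsSymmTensor k n A) (x : Fin n → ℝ) (i : Fin n) :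
    HasDerivAt (fun t : ℝ => tApply k n A (fun m => x m + t * (if m = i then 1 else 0)))
      (k * tApplyVec k n hk A x i) 0 := by
  unfold tApply
  have h : HasDerivAt (fun t : ℝ => ∑ f : Fin k → Fin n,
      A f * ∏ j : Fin k, (x (f j) + t * (if f j = i then 1 else 0)))
      (∑ f : Fin k → Fin n, A f * ∑ j : Fin k, (∏ l ∈ Finset.univ.erase j,
        (x (f l) + 0 * (if f l = i then 1 else 0))) • (if f j = i then (1:ℝ) else 0)) 0 := by
    refine HasDerivAt.fun_sum fun f _ => HasDerivAt.const_mul _ ?_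
    exact HasDerivAt.fun_finset_prod fun j _ => coord_deriv_aux n x i (f j)
  convert h using 1
  simp only [zero_mul, add_zero, smul_eq_mul, Finset.mul_sum]
  rw [Finset.sum_comm]
  rw [Finset.sum_congr rfl fun j _ => slot_aux k n hk A hsym x i j]
  simp

lemma pow_deriv_aux (k n : ℕ) (x : Fin n → ℝ) (i : Fin n) :
    HasDerivAt (fun t : ℝ => ∑ m, (x m + t * (if m = i then 1 else 0)) ^ k)
      (k * x i ^ (k - 1)) 0 := by
  have h : HasDerivAt (fun t : ℝ => ∑ m, (x m + t * (if m = i then 1 else 0)) ^ k)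
      (∑ m, (k : ℝ) * (x m + 0 * (if m = i then 1 else 0)) ^ (k - 1) * (if m = i then 1 else 0))
      0 :=
    HasDerivAt.fun_sum fun m _ => (coord_deriv_aux n x i m).fun_pow k
  convert h using 1
  simp

lemma exists_max_aux (k n : ℕ) (hk : 2 ≤ k) (hn : 1 ≤ n) (A : (Fin k → Fin n) → ℝ) :
    ∃ (M : ℝ) (x : Fin n → ℝ), x ≠ 0 ∧ (∀ i, 0 ≤ x i) ∧ tApply k n A x = M * ∑ i, x i ^ k ∧
      ∀ y : Fin n → ℝ, (∀ i, 0 ≤ y i) → tApply k n A y ≤ M * ∑ i, y i ^ k := by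
  have hpos : ∀ y : Fin n → ℝ, (∀ i, 0 ≤ y i) → y ≠ 0 → 0 < ∑ i, y i ^ k := by
    intro y hy hy0
    obtain ⟨i, hi⟩ := Function.ne_iff.mp hy0
    exact Finset.sum_pos' (fun i _ => pow_nonneg (hy i) k)
      ⟨i, Finset.mem_univ i, pow_pos (lt_of_le_of_ne (hy i) (Ne.symm hi)) k⟩
  let K : Set (Fin n → ℝ) := Metric.sphere 0 1 ∩ {x | ∀ i, 0 ≤ x i}
  have hK : IsCompact K := by
    refine (isCompact_sphere 0 1).inter_right ?_
    simp only [Set.setOf_forall]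
    exact isClosed_iInter fun i => isClosed_le continuous_const (continuous_apply i)
  have hK0 : ∀ y ∈ K, y ≠ 0 := by
    rintro y ⟨hy, -⟩ rfl
    simp at hy
  haveI : Nonempty (Fin n) := ⟨⟨0, by omega⟩⟩
  have hne : K.Nonempty := by
    refine ⟨fun _ => 1, ?_, fun i => zero_le_one⟩
    simp [pi_norm_const]
  have hcont : ContinuousOn (fun x => tApply k n A x / ∑ i, x i ^ k) K := by
    refine ContinuousOn.div ?_ ?_ ?_
    · unfold tApply; fun_prop
    · fun_prop
    · intro y hy
      exact (hpos y hy.2 (hK0 y hy)).ne'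
  obtain ⟨x, hx, hmax⟩ := hK.exists_isMaxOn hne hcont
  refine ⟨tApply k n A x / ∑ i, x i ^ k, x, hK0 x hx, hx.2, ?_, ?_⟩
  · rw [div_mul_cancel₀]
    exact (hpos x hx.2 (hK0 x hx)).ne'
  · intro y hy
    by_cases hy0 : y = 0
    · subst hy0
      have hk0 : k ≠ 0 := by omega
      simp [tApply, hk0]
    · have hny : 0 < ‖y‖ := norm_pos_iff.mpr hy0
      have hmem : (fun i => ‖y‖⁻¹ * y i) ∈ K := by
        refine ⟨?_, fun i => mul_nonneg (inv_nonneg.mpr hny.le) (hy i)⟩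
        have : (fun i => ‖y‖⁻¹ * y i) = ‖y‖⁻¹ • y := rfl
        rw [this, mem_sphere_zero_iff_norm, norm_smul, norm_inv, norm_norm, inv_mul_cancel₀ hny.ne']
      have h := hmax hmem
      simp only [Set.mem_setOf_eq, tApply_smul_aux, mul_pow, ← Finset.mul_sum] at h
      rw [mul_div_mul_left _ _ (by positivity), div_le_iff₀ (hpos y hy hy0)] at h
      exact h

lemma tApplyVec_nonneg_aux (k n : ℕ) (hk : 2 ≤ k) (A : (Fin k → Fin n) → ℝ)
    (hnn : ∀ f, 0 ≤ A f) (x : Fin n → ℝ) (hx : ∀ i, 0 ≤ x i) (i : Fin n) :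
    0 ≤ tApplyVec k n hk A x i :=
  Finset.sum_nonneg fun f _ => mul_nonneg (hnn f) (Finset.prod_nonneg fun j _ => hx (f j))

lemma exists_eig_aux (k n : ℕ) (hk : 2 ≤ k) (hn : 1 ≤ n) (A : (Fin k → Fin n) → ℝ)
    (hsym : IsSymmTensor k n A) (hnn : ∀ f, 0 ≤ A f) :
    ∃ M : ℝ, IsHEigenvalue k n hk A M ∧
      ∀ y : Fin n → ℝ, (∀ i, 0 ≤ y i) → tApply k n A y ≤ M * ∑ i, y i ^ k := by
  obtain ⟨M, x, hx0, hx, heq, hM⟩ := exists_max_aux k n hk hn A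
  refine ⟨M, ⟨x, hx0, fun i => ?_⟩, hM⟩
  have hk0 : (0:ℝ) < k := by exact_mod_cast (by omega : 0 < k)
  have hd := ((pow_deriv_aux k n x i).const_mul M).fun_sub (tApply_deriv_aux k n hk A hsym x i)
  set φ : ℝ → ℝ := fun t => M * ∑ m, (x m + t * (if m = i then 1 else 0)) ^ k
    - tApply k n A (fun m => x m + t * (if m = i then 1 else 0)) with hφ
  have hφ0 : φ 0 = 0 := by simp [hφ, heq]
  have hφn : ∀ t, -x i ≤ t → 0 ≤ φ t := by
    intro t ht
    refine sub_nonneg.mpr (hM _ fun m => ?_)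
    split_ifs with h
    · subst h; linarith
    · simpa using hx m
  rcases (hx i).eq_or_lt with h0 | h0
  · have hs := hd.tendsto_slope_zero_right
    have hge : 0 ≤ M * (k * x i ^ (k - 1)) - k * tApplyVec k n hk A x i := by
      refine ge_of_tendsto hs ?_
      filter_upwards [self_mem_nhdsWithin] with t ht
      have ht' : 0 < t := ht
      rw [zero_add, hφ0, sub_zero, smul_eq_mul]
      exact mul_nonneg (inv_nonneg.mpr ht'.le) (hφn t (by linarith))
    have hz : x i ^ (k - 1) = 0 := by rw [← h0]; exact zero_pow (by omega)
    have := tApplyVec_nonneg_aux k n hk A hnn x hx i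
    rw [hz] at hge ⊢
    nlinarith
  · have hmin : IsLocalMin φ 0 := by
      filter_upwards [Ioi_mem_nhds (show -x i < 0 by linarith)] with t ht
      rw [hφ0]
      exact hφn t (le_of_lt ht)
    have h := hmin.hasDerivAt_eq_zero hd
    have : (k:ℝ) * tApplyVec k n hk A x i = k * (M * x i ^ (k - 1)) := by linarith
    exact mul_left_cancel₀ hk0.ne' this

/-- the largest H-eigenvalue of a symmetric nonnegative tensor is at
least the average row sum and at least the largest diagonal entry. -/
theorem max_heigenvalue_ge_avg_rowSum_and_diag (k n : ℕ) (hk : 2 ≤ k) (hn : 1 ≤ n)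
    (A : (Fin k → Fin n) → ℝ) (hsym : IsSymmTensor k n A)
    (hnn : ∀ f : Fin k → Fin n, 0 ≤ A f)
    (lam : ℝ) (hlam : IsHEigenvalue k n hk A lam)
    (hmax : ∀ mu : ℝ, IsHEigenvalue k n hk A mu → mu ≤ lam) :
    (1 / (n : ℝ)) * ∑ i : Fin n, rowSum k n hk A i ≤ lam ∧
    Finset.univ.sup'
      (⟨(⟨0, by omega⟩ : Fin n), Finset.mem_univ _⟩ : (Finset.univ : Finset (Fin n)).Nonempty)
      (fun i : Fin n => A (fun _ => i)) ≤ lam := by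
  obtain ⟨M, hMe, hM⟩ := exists_eig_aux k n hk hn A hsym hnn
  have hle := hmax M hMe
  have hk0 : k ≠ 0 := by omega
  have hn0 : (0:ℝ) < n := by exact_mod_cast (by omega : 0 < n)
  constructor
  · refine le_trans ?_ hle
    have h := hM (fun _ => 1) (fun _ => zero_le_one)
    have hs : ∑ i : Fin n, rowSum k n hk A i = tApply k n A (fun _ => 1) := by
      unfold rowSum tApply
      rw [Finset.sum_fiberwise]
      simp
    rw [hs, one_div, inv_mul_le_iff₀ hn0]
    simpa [mul_comm] using h
  · refine le_trans (Finset.sup'_le _ _ fun i _ => ?_) hle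
    have hnon : ∀ m : Fin n, (0:ℝ) ≤ if m = i then 1 else 0 := by
      intro m; split_ifs <;> norm_num
    have h := hM (fun m => if m = i then 1 else 0) hnon
    have h1 : ∑ m : Fin n, (if m = i then (1:ℝ) else 0) ^ k = 1 := by
      simp [ite_pow, hk0]
    rw [h1, mul_one] at h
    refine le_trans ?_ h
    unfold tApply
    refine le_trans ?_ (Finset.single_le_sum
      (f := fun f : Fin k → Fin n => A f * ∏ j : Fin k, (if f j = i then (1:ℝ) else 0))
      (fun f _ => mul_nonneg (hnn f) (Finset.prod_nonneg fun j _ => hnon (f j)))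
      (Finset.mem_univ (fun _ => i)))
    simp
end

section
/- Let A be a symmetric, essentially nonnegative tensor of order k and dimension n, and suppose λ is the greatest H-eigenvalue of A (λ is an H-eigenvalue and every H-eigenvalue μ of A satisfies μ ≤ λ). Then λ is the maximum of the set {A x^k : x ∈ ℝ^n, x ≥ 0 componentwise, ∑_{i=1}^n x_i^k = 1}. -/
open Finset

theorem aux_mul_zero (k n : ℕ) (hk : 2 ≤ k) (x : Fin n → ℝ) (s : Fin n → ℝ)
    (A : (Fin k → Fin n) → ℝ) :
    ∑ i, s i * tApplyVec k n hk A x i =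
      ∑ f : Fin k → Fin n, A f * (s (f ⟨0, by omega⟩) *
        ∏ j ∈ Finset.univ.erase (⟨0, by omega⟩ : Fin k), x (f j)) := by
  unfold tApplyVec
  rw [← Finset.sum_fiberwise Finset.univ (fun f : Fin k → Fin n => f ⟨0, by omega⟩)]
  refine Finset.sum_congr rfl fun i _ => ?_
  rw [Finset.mul_sum]
  refine Finset.sum_congr rfl fun f hf => ?_
  rw [(Finset.mem_filter.1 hf).2]
  ring

theorem aux_euler (k n : ℕ) (hk : 2 ≤ k) (x : Fin n → ℝ) (A : (Fin k → Fin n) → ℝ) :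
    ∑ i, x i * tApplyVec k n hk A x i = tApply k n A x := by
  rw [aux_mul_zero]
  unfold tApply
  refine Finset.sum_congr rfl fun f _ => ?_
  rw [Finset.mul_prod_erase Finset.univ (fun j => x (f j)) (Finset.mem_univ _)]

theorem aux_smul (k n : ℕ) (x : Fin n → ℝ) (c : ℝ) (A : (Fin k → Fin n) → ℝ) :
    tApply k n A (fun i => c * x i) = c ^ k * tApply k n A x := by
  unfold tApply
  rw [Finset.mul_sum]
  refine Finset.sum_congr rfl fun f _ => ?_
  rw [Finset.prod_mul_distrib]
  simp
  ring

theorem aux_exists_max (k n : ℕ) (hk : 2 ≤ k) (hn : 1 ≤ n) (A : (Fin k → Fin n) → ℝ) :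
    ∃ y : Fin n → ℝ, (∀ i, 0 ≤ y i) ∧ ∑ i : Fin n, y i ^ k = 1 ∧
      ∀ x : Fin n → ℝ, (∀ i, 0 ≤ x i) → ∑ i : Fin n, x i ^ k = 1 →
        tApply k n A x ≤ tApply k n A y := by
  set S : Set (Fin n → ℝ) := {x | (∀ i, 0 ≤ x i) ∧ ∑ i : Fin n, x i ^ k = 1} with hS
  have hclosed : IsClosed S := by
    have h1 : IsClosed {x : Fin n → ℝ | ∀ i, 0 ≤ x i} := by
      simp only [Set.setOf_forall]
      exact isClosed_iInter fun i => isClosed_le continuous_const (continuous_apply i)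
    have h2 : IsClosed {x : Fin n → ℝ | ∑ i : Fin n, x i ^ k = 1} :=
      isClosed_eq (by fun_prop) continuous_const
    exact h1.inter h2
  have hsub : S ⊆ Set.Icc 0 1 := by
    rintro x ⟨h0, h1⟩
    refine ⟨h0, fun i => ?_⟩
    have : x i ^ k ≤ 1 := by
      rw [← h1]
      exact Finset.single_le_sum (f := fun i => x i ^ k) (fun j _ => pow_nonneg (h0 j) k)
        (Finset.mem_univ i)
    exact (pow_le_one_iff_of_nonneg (h0 i) (by omega)).1 this
  have hcomp : IsCompact S := isCompact_Icc.of_isClosed_subset hclosed hsub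
  have hne : S.Nonempty := by
    refine ⟨fun i => if i = ⟨0, by omega⟩ then 1 else 0, fun i => ?_, ?_⟩
    · dsimp only
      split_ifs <;> norm_num
    · have hk0 : k ≠ 0 := by omega
      simp [ite_pow, hk0]
  have hcont : ContinuousOn (tApply k n A) S := by
    apply Continuous.continuousOn
    unfold tApply
    fun_prop
  obtain ⟨y, hy, hym⟩ := hcomp.exists_isMaxOn hne hcont
  exact ⟨y, hy.1, hy.2, fun x h0 h1 => hym ⟨h0, h1⟩⟩

theorem aux_homog (k n : ℕ) (hk : 2 ≤ k) (A : (Fin k → Fin n) → ℝ) (M : ℝ)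
    (hM : ∀ x : Fin n → ℝ, (∀ i, 0 ≤ x i) → ∑ i : Fin n, x i ^ k = 1 → tApply k n A x ≤ M)
    (x : Fin n → ℝ) (hx : ∀ i, 0 ≤ x i) : tApply k n A x ≤ M * ∑ i, x i ^ k := by
  have hk0 : k ≠ 0 := by omega
  have hnn : 0 ≤ ∑ i, x i ^ k := Finset.sum_nonneg fun i _ => pow_nonneg (hx i) k
  rcases hnn.eq_or_lt with h | h
  · have hz : ∀ i, x i = 0 := by
      intro i
      have := (Finset.sum_eq_zero_iff_of_nonneg (fun i _ => pow_nonneg (hx i) k)).1 h.symm i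
        (Finset.mem_univ i)
      exact pow_eq_zero_iff hk0 |>.1 this
    rw [← h]
    simp [tApply, hz, hk0]
  · set T := ∑ i, x i ^ k with hT
    set c : ℝ := T ^ ((k : ℝ)⁻¹) with hc
    have hck : c ^ k = T := Real.rpow_inv_natCast_pow h.le hk0
    have hcpos : 0 < c := Real.rpow_pos_of_pos h _
    have h1 := hM (fun i => c⁻¹ * x i) (fun i => mul_nonneg (inv_nonneg.2 hcpos.le) (hx i)) (by
      simp only [mul_pow]
      rw [← Finset.mul_sum, ← hT, inv_pow, hck]
      exact inv_mul_cancel₀ h.ne')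
    rw [aux_smul, inv_pow, hck, inv_mul_le_iff₀ h] at h1
    linarith

theorem aux_symm (k n : ℕ) (hk : 2 ≤ k) (A : (Fin k → Fin n) → ℝ) (hsym : IsSymmTensor k n A)
    (y : Fin n → ℝ) (i : Fin n) (j : Fin k) :
    ∑ f : Fin k → Fin n, A f * ((∏ l ∈ Finset.univ.erase j, y (f l)) * (if f j = i then 1 else 0))
      = tApplyVec k n hk A y i := by
  unfold tApplyVec
  rw [Finset.sum_filter]
  set z : Fin k := ⟨0, by omega⟩ with hz
  rw [← Equiv.sum_comp ((Equiv.swap z j).arrowCongr (Equiv.refl (Fin n)))]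
  refine Finset.sum_congr rfl fun f _ => ?_
  have h1 : ((Equiv.swap z j).arrowCongr (Equiv.refl (Fin n))) f = f ∘ (Equiv.swap z j) := by
    ext l
    simp
  rw [h1, hsym]
  have h2 : ∏ l ∈ Finset.univ.erase j, y ((f ∘ (Equiv.swap z j)) l) =
      ∏ l ∈ Finset.univ.erase z, y (f l) := by
    refine Finset.prod_bij (fun l _ => Equiv.swap z j l) ?_ ?_ ?_ ?_
    · intro l hl
      simp only [Finset.mem_erase, Finset.mem_univ, and_true] at hl ⊢
      intro h
      apply hl
      have := congrArg (Equiv.swap z j) h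
      simpa using this
    · intro a _ b _ h
      exact (Equiv.swap z j).injective h
    · intro b hb
      refine ⟨Equiv.swap z j b, ?_, by simp⟩
      simp only [Finset.mem_erase, Finset.mem_univ, and_true] at hb ⊢
      intro h
      apply hb
      have := congrArg (Equiv.swap z j) h
      simpa using this
    · intro a _
      rfl
  rw [h2]
  simp

theorem aux_deriv (k n : ℕ) (hk : 2 ≤ k) (A : (Fin k → Fin n) → ℝ) (hsym : IsSymmTensor k n A)
    (y : Fin n → ℝ) (i : Fin n) :
    HasDerivAt (fun t : ℝ => tApply k n A (fun l => y l + t * (if l = i then 1 else 0)))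
      (k * tApplyVec k n hk A y i) 0 := by
  have h : HasDerivAt (fun t : ℝ => tApply k n A (fun l => y l + t * (if l = i then 1 else 0)))
      (∑ f : Fin k → Fin n, A f * ∑ j : Fin k,
        ((∏ l ∈ Finset.univ.erase j, y (f l)) * (if f j = i then 1 else 0))) 0 := by
    unfold tApply
    refine HasDerivAt.fun_sum fun f _ => HasDerivAt.const_mul _ ?_
    have := HasDerivAt.fun_finset_prod (u := (Finset.univ : Finset (Fin k))) (x := (0 : ℝ))
      (f := fun j t => y (f j) + t * (if f j = i then 1 else 0))
      (f' := fun j => if f j = i then 1 else 0) (fun j _ => by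
        simpa using ((hasDerivAt_id (0 : ℝ)).mul_const (if f j = i then (1 : ℝ) else 0)).const_add
          (y (f j)))
    simpa using this
  convert h using 1
  simp only [Finset.mul_sum]
  rw [Finset.sum_comm]
  simp only [aux_symm k n hk A hsym y i]
  simp

theorem aux_deriv_pow (k n : ℕ) (y : Fin n → ℝ) (i : Fin n) :
    HasDerivAt (fun t : ℝ => ∑ l, (y l + t * (if l = i then 1 else 0)) ^ k)
      (k * y i ^ (k - 1)) 0 := by
  have h : HasDerivAt (fun t : ℝ => ∑ l, (y l + t * (if l = i then 1 else 0)) ^ k)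
      (∑ l, k * (y l) ^ (k - 1) * (if l = i then 1 else 0)) 0 := by
    refine HasDerivAt.fun_sum fun l _ => ?_
    have := (((hasDerivAt_id (0 : ℝ)).mul_const (if l = i then (1 : ℝ) else 0)).const_add
          (y l)).fun_pow k
    simpa using this
  convert h using 1
  simp

theorem aux_kkt (k n : ℕ) (hk : 2 ≤ k) (A : (Fin k → Fin n) → ℝ) (hsym : IsSymmTensor k n A)
    (M : ℝ) (hM : ∀ x : Fin n → ℝ, (∀ i, 0 ≤ x i) → tApply k n A x ≤ M * ∑ i, x i ^ k)
    (y : Fin n → ℝ) (hy : ∀ i, 0 ≤ y i) (hyM : tApply k n A y = M * ∑ i, y i ^ k) (i : Fin n) :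
    tApplyVec k n hk A y i ≤ M * y i ^ (k - 1) := by
  have hd := ((aux_deriv_pow k n y i).const_mul M).sub (aux_deriv k n hk A hsym y i)
  have ht := hd.tendsto_slope_zero_right
  have h0 : 0 ≤ M * (k * y i ^ (k - 1)) - k * tApplyVec k n hk A y i := by
    refine ge_of_tendsto ht ?_
    filter_upwards [self_mem_nhdsWithin] with t ht
    have ht : 0 < t := ht
    have := hM (fun l => y l + t * (if l = i then 1 else 0)) (fun l => by
      have := hy l
      split_ifs <;> simp <;> linarith)
    simp only [Pi.sub_apply, zero_add, zero_mul, add_zero, hyM, smul_eq_mul]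
    refine mul_nonneg (inv_nonneg.2 ht.le) ?_
    linarith
  have hkp : (0 : ℝ) < k := by exact_mod_cast (by omega : 0 < k)
  have : 0 ≤ k * (M * y i ^ (k - 1) - tApplyVec k n hk A y i) := by linarith
  have := nonneg_of_mul_nonneg_right this hkp
  linarith

theorem aux_eigen (k n : ℕ) (hk : 2 ≤ k) (A : (Fin k → Fin n) → ℝ) (hsym : IsSymmTensor k n A)
    (hess : ∀ f : Fin k → Fin n, (¬ ∃ i : Fin n, ∀ j : Fin k, f j = i) → 0 ≤ A f)
    (M : ℝ) (hM : ∀ x : Fin n → ℝ, (∀ i, 0 ≤ x i) → tApply k n A x ≤ M * ∑ i, x i ^ k)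
    (y : Fin n → ℝ) (hy : ∀ i, 0 ≤ y i) (hyM : tApply k n A y = M * ∑ i, y i ^ k) (i : Fin n) :
    tApplyVec k n hk A y i = M * y i ^ (k - 1) := by
  have hkkt := aux_kkt k n hk A hsym M hM y hy hyM
  have hpow : ∀ a : ℝ, a * a ^ (k - 1) = a ^ k := fun a => mul_pow_sub_one (by omega) a
  rcases (hy i).eq_or_lt with h | h
  · refine le_antisymm (hkkt i) ?_
    rw [← h, zero_pow (by omega), mul_zero]
    unfold tApplyVec
    refine Finset.sum_nonneg fun f hf => ?_
    have hf0 := (Finset.mem_filter.1 hf).2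
    by_cases hdiag : ∃ i : Fin n, ∀ j : Fin k, f j = i
    · obtain ⟨i', hi'⟩ := hdiag
      have : i' = i := by rw [← hf0, hi']
      subst this
      rw [Finset.prod_eq_zero (i := (⟨1, by omega⟩ : Fin k)), mul_zero]
      · simp [Fin.ext_iff]
      · rw [hi', ← h]
    · exact mul_nonneg (hess f hdiag) (Finset.prod_nonneg fun j _ => hy _)
  · have hs : ∑ i, y i * (M * y i ^ (k - 1) - tApplyVec k n hk A y i) = 0 := by
      simp only [mul_sub, Finset.sum_sub_distrib]
      rw [aux_euler, hyM, Finset.mul_sum, sub_eq_zero]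
      refine Finset.sum_congr rfl fun l _ => ?_
      rw [← hpow]
      ring
    have := (Finset.sum_eq_zero_iff_of_nonneg (fun l _ =>
      mul_nonneg (hy l) (sub_nonneg.2 (hkkt l)))).1 hs i (Finset.mem_univ i)
    rcases mul_eq_zero.1 this with h' | h'
    · exact absurd h' h.ne'
    · linarith

theorem aux_upper (k n : ℕ) (hk : 2 ≤ k) (A : (Fin k → Fin n) → ℝ)
    (hess : ∀ f : Fin k → Fin n, (¬ ∃ i : Fin n, ∀ j : Fin k, f j = i) → 0 ≤ A f)
    (M : ℝ) (hM : ∀ x : Fin n → ℝ, (∀ i, 0 ≤ x i) → tApply k n A x ≤ M * ∑ i, x i ^ k)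
    (lam : ℝ) (hlam : IsHEigenvalue k n hk A lam) : lam ≤ M := by
  obtain ⟨x, hx0, hx⟩ := hlam
  have hpow : ∀ a : ℝ, a * a ^ (k - 1) = a ^ k := fun a => mul_pow_sub_one (by omega) a
  have hs : ∀ i, ∃ s : ℝ, |s| = |x i| ∧ s * x i ^ (k - 1) = |x i| ^ k := by
    intro i
    rcases Nat.even_or_odd k with h | h
    · exact ⟨x i, rfl, by rw [hpow, h.pow_abs]⟩
    · refine ⟨|x i|, abs_abs _, ?_⟩
      have h' : Even (k - 1) := by
        obtain ⟨m, hm⟩ := h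
        exact ⟨m, by omega⟩
      rw [← h'.pow_abs, hpow]
  choose s hs1 hs2 using hs
  have h1 : ∑ i, s i * tApplyVec k n hk A x i = lam * ∑ i, |x i| ^ k := by
    rw [Finset.mul_sum]
    refine Finset.sum_congr rfl fun i _ => ?_
    rw [hx, ← hs2]
    ring
  have h2 : ∑ i, s i * tApplyVec k n hk A x i ≤ tApply k n A (fun i => |x i|) := by
    rw [aux_mul_zero]
    unfold tApply
    refine Finset.sum_le_sum fun f _ => ?_
    by_cases hdiag : ∃ i : Fin n, ∀ j : Fin k, f j = i
    · obtain ⟨i, hi⟩ := hdiag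
      simp only [hi]
      refine le_of_eq ?_
      rw [Finset.prod_const, Finset.prod_const, Finset.card_erase_of_mem (Finset.mem_univ _),
        Finset.card_univ, Fintype.card_fin, hs2]
    · refine mul_le_mul_of_nonneg_left ?_ (hess f hdiag)
      refine (le_abs_self _).trans (le_of_eq ?_)
      rw [abs_mul, hs1, Finset.abs_prod,
        Finset.mul_prod_erase Finset.univ (fun j => |x (f j)|) (Finset.mem_univ _)]
  have h3 := hM (fun i => |x i|) (fun i => abs_nonneg _)
  have hpos : 0 < ∑ i, |x i| ^ k := by
    obtain ⟨i, hi⟩ := Function.ne_iff.1 hx0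
    exact Finset.sum_pos' (fun j _ => pow_nonneg (abs_nonneg _) k)
      ⟨i, Finset.mem_univ i, pow_pos (abs_pos.2 hi) k⟩
  exact le_of_mul_le_mul_right (by linarith) hpos

/-- maximum property of the largest H-eigenvalue of a symmetric,
essentially nonnegative tensor. -/
theorem max_heigenvalue_of_symm_ess_nonneg (k n : ℕ) (hk : 2 ≤ k) (hn : 1 ≤ n)
    (A : (Fin k → Fin n) → ℝ) (hsym : IsSymmTensor k n A)
    (hess : ∀ f : Fin k → Fin n, (¬ ∃ i : Fin n, ∀ j : Fin k, f j = i) → 0 ≤ A f)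
    (lam : ℝ) (hlam : IsHEigenvalue k n hk A lam)
    (hmax : ∀ mu : ℝ, IsHEigenvalue k n hk A mu → mu ≤ lam) :
    (∀ x : Fin n → ℝ, (∀ i, 0 ≤ x i) → ∑ i : Fin n, x i ^ k = 1 →
      tApply k n A x ≤ lam) ∧
    ∃ y : Fin n → ℝ, (∀ i, 0 ≤ y i) ∧ ∑ i : Fin n, y i ^ k = 1 ∧
      tApply k n A y = lam := by
  obtain ⟨y, hy0, hy1, hym⟩ := aux_exists_max k n hk hn A
  have hM := aux_homog k n hk A _ hym
  have hle : lam ≤ tApply k n A y := aux_upper k n hk A hess _ hM lam hlam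
  have hge : tApply k n A y ≤ lam := by
    refine hmax _ ⟨y, ?_, aux_eigen k n hk A hsym hess _ hM y hy0 (by rw [hy1, mul_one])⟩
    rintro rfl
    have hk0 : k ≠ 0 := by omega
    simp [hk0] at hy1
  exact ⟨fun x h0 h1 => (hym x h0 h1).trans hge, y, hy0, hy1, le_antisymm hge hle⟩
end

section
/- Let A be a symmetric, essentially nonpositive tensor of order k and dimension n. If every row sum of A is strictly positive, i.e., R_i(A) > 0 for i = 1,…,n, then A is strictly copositive. -/
open Finset

theorem amgm_aux (k : ℕ) (hk : k ≠ 0) (z : Fin k → ℝ) (hz : ∀ j, 0 ≤ z j) :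
    (k : ℝ) * ∏ j, z j ≤ ∑ j, z j ^ k := by
  have hk' : (0 : ℝ) < k := by positivity
  have h := Real.geom_mean_le_arith_mean_weighted (Finset.univ : Finset (Fin k))
    (fun _ => (k : ℝ)⁻¹) (fun j => z j ^ k) (fun _ _ => by positivity)
    (by simp [hk]) (fun j _ => pow_nonneg (hz j) k)
  have e : ∀ j, (z j ^ k) ^ ((k : ℝ)⁻¹) = z j := fun j => Real.pow_rpow_inv_natCast (hz j) hk
  simp only [e] at h
  rw [← Finset.mul_sum] at h
  calc (k : ℝ) * ∏ j, z j ≤ k * ((k : ℝ)⁻¹ * ∑ j, z j ^ k) := by gcongr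
    _ = _ := by field_simp

/-- a symmetric, essentially nonpositive tensor all of whose row
sums are positive is strictly copositive. -/
theorem strictly_copositive_of_ess_nonpos_rowSum_pos (k n : ℕ) (hk : 2 ≤ k) (hn : 1 ≤ n)
    (A : (Fin k → Fin n) → ℝ) (hsym : IsSymmTensor k n A)
    (hess : ∀ f : Fin k → Fin n, (¬ ∃ i : Fin n, ∀ j : Fin k, f j = i) → A f ≤ 0)
    (hrow : ∀ i : Fin n, 0 < rowSum k n hk A i) :
    ∀ x : Fin n → ℝ, (∀ i, 0 ≤ x i) → x ≠ 0 → 0 < tApply k n A x := by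
  intro x hx hx0
  have hk0 : k ≠ 0 := by omega
  have hkp : (0 : ℝ) < k := by positivity
  have hpt : ∀ f : Fin k → Fin n,
      A f * ∑ j, x (f j) ^ k ≤ k * (A f * ∏ j, x (f j)) := by
    intro f
    by_cases hf : ∃ i : Fin n, ∀ j : Fin k, f j = i
    · obtain ⟨i, hi⟩ := hf
      simp only [hi, Finset.sum_const, Finset.prod_const, Finset.card_univ, Fintype.card_fin,
        nsmul_eq_mul]
      exact le_of_eq (by ring)
    · have h1 := amgm_aux k hk0 (fun j => x (f j)) (fun j => hx _)
      have h2 := mul_le_mul_of_nonpos_left h1 (hess f hf)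
      linarith
  have hswap : ∀ j : Fin k, ∑ f : Fin k → Fin n, A f * x (f j) ^ k
      = ∑ f : Fin k → Fin n, A f * x (f ⟨0, by omega⟩) ^ k := by
    intro j
    refine Fintype.sum_equiv (Equiv.arrowCongr (Equiv.swap j ⟨0, by omega⟩) (Equiv.refl _)) _ _ ?_
    intro f
    have : (Equiv.arrowCongr (Equiv.swap j ⟨0, by omega⟩) (Equiv.refl (Fin n))) f
        = f ∘ (Equiv.swap j ⟨0, by omega⟩) := by
      ext t; simp [Equiv.arrowCongr]
    rw [this, hsym]
    simp
  have hrowsum : ∑ f : Fin k → Fin n, A f * x (f ⟨0, by omega⟩) ^ k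
      = ∑ i, rowSum k n hk A i * x i ^ k := by
    rw [← Finset.sum_fiberwise (Finset.univ) (fun f : Fin k → Fin n => f ⟨0, by omega⟩)]
    refine Finset.sum_congr rfl fun i _ => ?_
    rw [rowSum, Finset.sum_mul]
    refine Finset.sum_congr rfl fun f hf => ?_
    rw [(Finset.mem_filter.mp hf).2]
  have hpos : 0 < ∑ i, rowSum k n hk A i * x i ^ k := by
    obtain ⟨i, hi⟩ := Function.ne_iff.mp hx0
    refine Finset.sum_pos' (fun i _ => mul_nonneg (hrow i).le (pow_nonneg (hx i) k))
      ⟨i, Finset.mem_univ _, mul_pos (hrow i) (pow_pos (lt_of_le_of_ne (hx i) (Ne.symm hi)) k)⟩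
  have hsum := Finset.sum_le_sum (fun f (_ : f ∈ (Finset.univ : Finset (Fin k → Fin n))) => hpt f)
  rw [← Finset.mul_sum] at hsum
  simp only [Finset.mul_sum (Finset.univ : Finset (Fin k))] at hsum
  rw [Finset.sum_comm, Finset.sum_congr rfl (fun j _ => hswap j), hrowsum] at hsum
  simp only [Finset.sum_const, Finset.card_univ, Fintype.card_fin, nsmul_eq_mul] at hsum
  have h3 := lt_of_lt_of_le (mul_pos hkp hpos) hsum
  exact pos_of_mul_pos_right h3 hkp.le
end
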